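/- arXiv:1412.0080 — 2 statements merged into one kernel-verified Lean document; each statement's English description precedes it below -/
import Mathlib

section
/- Let (X,σ) be an infinite minimal one-sided shift whose complexity function satisfies p(n+1) − p(n) ≤ L for all n ≥ 1. Then X has at most L branch points, i.e., at most L points x ∈ X having at least two preimages under σ in X. -/
/-- The one-sided shift map on `A^ℕ`. -/
def shiftN {A : Type*} (x : ℕ → A) : ℕ → A := fun n => x (n + 1)

/-- The complexity function: the number of words of length `n` occurring in points of `X`. -/
noncomputable def complexityN {A : Type*} [Fintype A] (X : Set (ℕ → A)) (n : ℕ) : ℕ :=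
  Nat.card {w : Fin n → A | ∃ x ∈ X, ∃ i : ℕ, ∀ j : Fin n, w j = x (i + (j : ℕ))}

/-- `X` has sublinear complexity: `p(n) ≤ C n` for all `n ≥ 1`. -/
def SublinearComplexityN {A : Type*} [Fintype A] (X : Set (ℕ → A)) : Prop :=
  ∃ C : ℕ, ∀ n : ℕ, 1 ≤ n → complexityN X n ≤ C * n

/-- Minimality of a one-sided shift: every forward orbit is dense in `X`. -/
def MinimalN {A : Type*} [TopologicalSpace A] (X : Set (ℕ → A)) : Prop :=
  ∀ x ∈ X, X ⊆ closure {y : ℕ → A | ∃ n : ℕ, y = shiftN^[n] x}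

/-- `x` is a branch point of `X`: it lies in `X` and has at least two σ-preimages in `X`. -/
def IsBranchPoint {A : Type*} (X : Set (ℕ → A)) (x : ℕ → A) : Prop :=
  x ∈ X ∧ ∃ y ∈ X, ∃ z ∈ X, y ≠ z ∧ shiftN y = x ∧ shiftN z = x

/-- The set of words of length `n` occurring in points of `X`. -/
def wordsN {A : Type*} (X : Set (ℕ → A)) (n : ℕ) : Set (Fin n → A) :=
  {w : Fin n → A | ∃ x ∈ X, ∃ i : ℕ, ∀ j : Fin n, w j = x (i + (j : ℕ))}

/-- The prefix of length `n` of a point. -/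
def prefixN {A : Type*} (n : ℕ) (x : ℕ → A) : Fin n → A := fun j => x j

theorem shiftN_iterate_apply {A : Type*} (x : ℕ → A) (i n : ℕ) :
    shiftN^[i] x n = x (i + n) := by
  induction i generalizing x with
  | zero => simp
  | succ i ih =>
    rw [Function.iterate_succ_apply, ih]
    exact congrArg x (by omega)

theorem shiftN_iterate_mem {A : Type*} {X : Set (ℕ → A)} (hinv : ∀ x ∈ X, shiftN x ∈ X)
    {x : ℕ → A} (hx : x ∈ X) (i : ℕ) : shiftN^[i] x ∈ X :=
  (show Set.MapsTo shiftN X X from fun x hx => hinv x hx).iterate i hx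

theorem prefixN_mem_wordsN {A : Type*} {X : Set (ℕ → A)} {x : ℕ → A} (hx : x ∈ X) (n : ℕ) :
    prefixN n x ∈ wordsN X n :=
  ⟨x, hx, 0, fun j => by simp [prefixN]⟩

theorem tail_prefixN {A : Type*} (n : ℕ) (x : ℕ → A) :
    Fin.tail (prefixN (n + 1) x) = prefixN n (shiftN x) := by
  ext j
  simp [Fin.tail, prefixN, shiftN]

/-- In a minimal one-sided shift every word extends to the left. -/
theorem exists_left_extension {A : Type*} [TopologicalSpace A] [DiscreteTopology A]
    {X : Set (ℕ → A)} (hinv : ∀ x ∈ X, shiftN x ∈ X) (hmin : MinimalN X) {n : ℕ}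
    {w : Fin n → A} (hw : w ∈ wordsN X n) : ∃ v ∈ wordsN X (n + 1), Fin.tail v = w := by
  obtain ⟨x, hx, i, hi⟩ := hw
  have hy := shiftN_iterate_mem hinv hx i
  set y := shiftN^[i] x with hydef
  have hwy : prefixN n y = w := by
    ext j
    rw [hi j, hydef, prefixN, shiftN_iterate_apply]
  have hcont : Continuous (prefixN n : (ℕ → A) → Fin n → A) :=
    continuous_pi fun j => continuous_apply (j : ℕ)
  have hopen : IsOpen (prefixN n ⁻¹' {w} : Set (ℕ → A)) :=
    (isOpen_discrete {w}).preimage hcont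
  obtain ⟨z, hz, m, rfl⟩ := mem_closure_iff.1 (hmin _ (hinv y hy) hy) _ hopen hwy
  refine ⟨prefixN (n + 1) (shiftN^[m] y),
    prefixN_mem_wordsN (shiftN_iterate_mem hinv hy m) _, ?_⟩
  rw [tail_prefixN, ← Function.iterate_succ_apply' shiftN, Function.iterate_succ_apply]
  exact hz

/-- Finitely many points are separated by their prefixes of some positive length. -/
theorem exists_injOn_prefixN {A : Type*} (S : Finset (ℕ → A)) :
    ∃ n, 1 ≤ n ∧ Set.InjOn (prefixN n) (S : Set (ℕ → A)) := by
  have h : ∀ p : (ℕ → A) × (ℕ → A), ∃ i, p.1 ≠ p.2 → p.1 i ≠ p.2 i := fun p => by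
    by_cases hp : p.1 = p.2
    · exact ⟨0, fun h => absurd hp h⟩
    · obtain ⟨i, hi⟩ := Function.ne_iff.1 hp
      exact ⟨i, fun _ => hi⟩
  choose f hf using h
  refine ⟨(S ×ˢ S).sup f + 1, Nat.le_add_left _ _, fun x hx y hy hxy => ?_⟩
  by_contra hne
  have hle : f (x, y) ≤ (S ×ˢ S).sup f :=
    Finset.le_sup (Finset.mem_product.2 ⟨hx, hy⟩)
  exact hf (x, y) hne (congrFun hxy ⟨f (x, y), Nat.lt_succ_of_le hle⟩)

/-- The prefix of a branch point has a left extension different from any given word. -/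
theorem IsBranchPoint.exists_left_extension_ne {A : Type*} {X : Set (ℕ → A)} {x : ℕ → A}
    (hx : IsBranchPoint X x) (n : ℕ) (u : Fin (n + 1) → A) :
    ∃ v ∈ wordsN X (n + 1), Fin.tail v = prefixN n x ∧ v ≠ u := by
  obtain ⟨-, y, hy, z, hz, hyz, rfl, hzy⟩ := hx
  by_cases hyu : prefixN (n + 1) y = u
  · refine ⟨prefixN (n + 1) z, prefixN_mem_wordsN hz _, by rw [tail_prefixN, hzy], ?_⟩
    rintro rfl
    apply hyz
    ext i
    cases i with
    | zero => exact congrFun hyu 0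
    | succ i => exact (congrFun hzy i).symm
  · exact ⟨prefixN (n + 1) y, prefixN_mem_wordsN hy _, tail_prefixN n y, hyu⟩

/-- Branch points separated by their prefixes of length `n` contribute to `p(n + 1) - p(n)`. -/
theorem complexityN_add_card_le {A : Type*} [Fintype A] [TopologicalSpace A]
    [DiscreteTopology A] {X : Set (ℕ → A)} (hinv : ∀ x ∈ X, shiftN x ∈ X)
    (hmin : MinimalN X) {S : Finset (ℕ → A)} (hS : ∀ x ∈ S, IsBranchPoint X x) {n : ℕ}
    (hn : Set.InjOn (prefixN n) (S : Set (ℕ → A))) :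
    complexityN X n + S.card ≤ complexityN X (n + 1) := by
  choose e he htail using
    fun w : wordsN X n => exists_left_extension hinv hmin w.2
  choose g hg hgtail hgne using fun x : S =>
    (hS x x.2).exists_left_extension_ne n (e ⟨_, prefixN_mem_wordsN (hS x x.2).1 n⟩)
  let F : wordsN X n ⊕ S → wordsN X (n + 1) :=
    Sum.elim (fun w => ⟨e w, he w⟩) (fun x => ⟨g x, hg x⟩)
  have hne : ∀ w x, e w ≠ g x := by
    intro w x h
    have hw : w = ⟨_, prefixN_mem_wordsN (hS x x.2).1 n⟩ :=
      Subtype.ext (by rw [← htail w, h, hgtail])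
    exact hgne x (by rw [← h, ← hw])
  have hF : Function.Injective F := by
    refine Function.Injective.sumElim (fun w w' h => Subtype.ext ?_)
      (fun x x' h => Subtype.ext (hn x.2 x'.2 ?_)) fun w x h => hne w x (Subtype.ext_iff.1 h)
    · rw [← htail w, ← htail w', show e w = e w' from Subtype.ext_iff.1 h]
    · rw [← hgtail x, ← hgtail x', show g x = g x' from Subtype.ext_iff.1 h]
  have := Nat.card_le_card_of_injective F hF
  rwa [Nat.card_sum, Nat.card_eq_fintype_card (α := S), Fintype.card_coe] at this

/-- An infinite minimal one-sided shift whose complexity difference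
function is bounded by `L` has at most `L` branch points. -/
theorem card_branch_points_le_complexity_difference_bound
    {A : Type*} [Fintype A] [TopologicalSpace A] [DiscreteTopology A]
    (X : Set (ℕ → A)) (hne : X.Nonempty) (hclosed : IsClosed X)
    (hinv : ∀ x ∈ X, shiftN x ∈ X)
    (hmin : MinimalN X) (hinf : X.Infinite)
    (L : ℕ) (hL : ∀ n : ℕ, 1 ≤ n → complexityN X (n + 1) ≤ complexityN X n + L) :
    {x : ℕ → A | IsBranchPoint X x}.Finite ∧
      {x : ℕ → A | IsBranchPoint X x}.ncard ≤ L := by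
  rw [← Set.encard_le_coe_iff_finite_ncard_le]
  by_contra! hlt
  obtain ⟨T, hTX, hT⟩ := Set.exists_subset_encard_eq (Order.add_one_le_of_lt hlt)
  have hfin : T.Finite := Set.finite_of_encard_eq_coe (k := L + 1) (by simpa using hT)
  lift T to Finset (ℕ → A) using hfin
  rw [Set.encard_coe_eq_coe_finsetCard] at hT
  have hcard : T.card = L + 1 := by exact_mod_cast hT
  obtain ⟨n, hn, hinj⟩ := exists_injOn_prefixN T
  have h := complexityN_add_card_le hinv hmin (fun x hx => hTX hx) hinj
  have := hL n hn
  omega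
end

section
/- Let (X̄,σ̄) be an infinite minimal two-sided shift and let Φ be an automorphism of (X̄,σ̄). Suppose x̄, ȳ ∈ X̄ are right asymptotic points and Φ maps the σ̄-orbit of x̄ into the σ̄-orbit of ȳ. Then Φ = σ̄^n for some n ∈ ℤ. -/
/-- The two-sided shift map on `A^ℤ`. -/
def shiftZ {A : Type*} (x : ℤ → A) : ℤ → A := fun n => x (n + 1)

/-- The `n`-th power of the two-sided shift, `n ∈ ℤ`. -/
def shiftZIter {A : Type*} (n : ℤ) (x : ℤ → A) : ℤ → A := fun m => x (m + n)

/-- The (two-sided) shift orbit of a point. -/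
def orbitZ {A : Type*} (x : ℤ → A) : Set (ℤ → A) :=
  Set.range fun n : ℤ => shiftZIter n x

/-- Two points of `A^ℤ` are right asymptotic if they eventually agree to the right. -/
def RightAsymptotic {A : Type*} (x y : ℤ → A) : Prop :=
  ∃ N : ℤ, ∀ n : ℤ, N ≤ n → x n = y n

/-- Minimality of a two-sided shift: every orbit is dense in `X`. -/
def MinimalZ {A : Type*} [TopologicalSpace A] (X : Set (ℤ → A)) : Prop :=
  ∀ x ∈ X, X ⊆ closure (orbitZ x)

/-- An automorphism of the two-sided shift `(X, σ̄)`: a self-homeomorphism of `X`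
commuting with the shift. -/
def IsAutZ {A : Type*} [TopologicalSpace A] (X : Set (ℤ → A)) (Φ : X ≃ₜ X) : Prop :=
  ∀ x y : X, (y : ℤ → A) = shiftZ (x : ℤ → A) → (Φ y : ℤ → A) = shiftZ (Φ x : ℤ → A)

open Filter Topology

theorem shiftZIter_add {A : Type*} (m n : ℤ) (x : ℤ → A) :
    shiftZIter (m + n) x = shiftZIter m (shiftZIter n x) := by
  funext k
  simp [shiftZIter, add_assoc]

theorem shiftZIter_zero {A : Type*} (x : ℤ → A) : shiftZIter 0 x = x := by
  funext k
  simp [shiftZIter]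

theorem continuous_shiftZIter {A : Type*} [TopologicalSpace A] (n : ℤ) :
    Continuous (shiftZIter n : (ℤ → A) → ℤ → A) :=
  continuous_pi fun m => continuous_apply (m + n)

theorem shiftZIter_mem {A : Type*} {X : Set (ℤ → A)} (hinv : shiftZ '' X = X)
    {x : ℤ → A} (hx : x ∈ X) (n : ℤ) : shiftZIter n x ∈ X := by
  induction n with
  | zero => rwa [shiftZIter_zero]
  | succ n ih =>
    rw [add_comm, shiftZIter_add, ← hinv]
    exact ⟨_, ih, rfl⟩
  | pred n ih =>
    rw [← hinv] at ih
    obtain ⟨w, hw, h⟩ := ih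
    have : shiftZIter (-n - 1) x = w := by
      funext k
      have := congrFun h (k - 1)
      simp only [shiftZ, shiftZIter, sub_add_cancel] at this ⊢
      rw [this]
      congr 1
      ring
    rwa [this]

/-- An automorphism commutes with all powers of the shift. -/
theorem IsAutZ.map_shiftZIter {A : Type*} [TopologicalSpace A] {X : Set (ℤ → A)}
    {Φ : X ≃ₜ X} (hΦ : IsAutZ X Φ) (hinv : shiftZ '' X = X) (x : X) (n : ℤ) :
    (Φ ⟨shiftZIter n x, shiftZIter_mem hinv x.2 n⟩ : ℤ → A) = shiftZIter n (Φ x) := by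
  induction n with
  | zero => simp only [shiftZIter_zero]
  | succ n ih =>
    rw [hΦ ⟨shiftZIter n x, shiftZIter_mem hinv x.2 n⟩ _
      ((congrArg (shiftZIter · (x : ℤ → A)) (add_comm _ _)).trans (shiftZIter_add 1 _ _)),
      ih, add_comm, shiftZIter_add]
    rfl
  | pred n ih =>
    have h := hΦ ⟨shiftZIter (-n - 1) x, shiftZIter_mem hinv x.2 _⟩
      ⟨shiftZIter (-n) x, shiftZIter_mem hinv x.2 _⟩ (by
        funext k
        simp only [shiftZ, shiftZIter]
        ring_nf)
    rw [ih] at h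
    funext k
    have := congrFun h (k - 1)
    simp only [shiftZ, sub_add_cancel] at this
    rw [← this]
    simp only [shiftZIter]
    ring_nf

/-- In a minimal shift every point is a limit point of every forward orbit. -/
theorem MinimalZ.mapClusterPt_atTop {A : Type*} [Finite A] [TopologicalSpace A]
    {X : Set (ℤ → A)} (hclosed : IsClosed X) (hinv : shiftZ '' X = X)
    (hmin : MinimalZ X) {x z : ℤ → A} (hx : x ∈ X) (hz : z ∈ X) :
    MapClusterPt z atTop (fun n : ℤ => shiftZIter n x) := by
  obtain ⟨w, hw, hwc⟩ := hclosed.isCompact.exists_mapClusterPt (f := atTop)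
    (u := fun n : ℤ => shiftZIter n x)
    (tendsto_principal.2 (Eventually.of_forall fun n => shiftZIter_mem hinv hx n))
  refine closure_minimal ?_ (isClosed_setOfPred_clusterPt (f := map _ atTop)) (hmin w hw hz)
  rintro _ ⟨k, rfl⟩
  have h := hwc.continuousAt_comp (continuous_shiftZIter k).continuousAt
  have heq : shiftZIter k ∘ (fun n : ℤ => shiftZIter n x)
      = (fun n : ℤ => shiftZIter n x) ∘ fun n => k + n := by
    funext n
    exact (shiftZIter_add k n x).symm
  rw [heq] at h
  exact h.of_comp (tendsto_atTop_add_const_left _ k tendsto_id)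

/-- If an automorphism of an infinite minimal two-sided shift maps the
orbit of `x̄` into the orbit of `ȳ`, where `x̄` and `ȳ` are right asymptotic, then it is a
power of the shift. -/
theorem aut_preserving_RA_orbit_is_shift_power
    {A : Type*} [Fintype A] [TopologicalSpace A] [DiscreteTopology A]
    (X : Set (ℤ → A)) (hne : X.Nonempty) (hclosed : IsClosed X)
    (hinv : shiftZ '' X = X)
    (hmin : MinimalZ X) (hinf : X.Infinite)
    (Φ : X ≃ₜ X) (hΦ : IsAutZ X Φ)
    (x y : X) (hra : RightAsymptotic (x : ℤ → A) (y : ℤ → A))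
    (horb : ∀ z : X, (z : ℤ → A) ∈ orbitZ (x : ℤ → A) → (Φ z : ℤ → A) ∈ orbitZ (y : ℤ → A)) :
    ∃ n : ℤ, ∀ z : X, (Φ z : ℤ → A) = shiftZIter n (z : ℤ → A) := by
  obtain ⟨m, hm⟩ := horb x ⟨0, shiftZIter_zero _⟩
  obtain ⟨N, hN⟩ := hra
  refine ⟨m, fun z => funext fun k => ?_⟩
  let u : ℤ → X := fun n => ⟨shiftZIter n x, shiftZIter_mem hinv x.2 n⟩
  have hu : MapClusterPt z atTop u :=
    IsInducing.subtypeVal.mapClusterPt_iff.1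
      (hmin.mapClusterPt_atTop hclosed hinv x.2 z.2)
  have h₁ : ∀ᶠ w in 𝓝 z, (Φ w : ℤ → A) k = (Φ z : ℤ → A) k := by
    have hc : Continuous fun w => (Φ w : ℤ → A) k :=
      (continuous_apply k).comp (continuous_subtype_val.comp Φ.continuous)
    exact hc.continuousAt (IsOpen.mem_nhds (isOpen_discrete {(Φ z : ℤ → A) k}) rfl)
  have h₂ : ∀ᶠ w : X in 𝓝 z, (w : ℤ → A) (k + m) = (z : ℤ → A) (k + m) := by
    have hc : Continuous fun w : X => (w : ℤ → A) (k + m) :=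
      (continuous_apply (k + m)).comp continuous_subtype_val
    exact hc.continuousAt (IsOpen.mem_nhds (isOpen_discrete {(z : ℤ → A) (k + m)}) rfl)
  obtain ⟨n, ⟨hn₁, hn₂⟩, hn⟩ :=
    ((hu.frequently (h₁.and h₂)).and_eventually (eventually_ge_atTop (N - k - m))).exists
  rw [← hn₁, hΦ.map_shiftZIter hinv x n, ← hm]
  refine Eq.trans ?_ hn₂
  simp only [shiftZIter, u]
  rw [hN _ (by linarith)]
  ring_nf
end
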